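/- arXiv:0903.2178 — 5 statements merged into one kernel-verified Lean document; each statement's English description precedes it below -/
import Mathlib

section
/- The bracket of the standard q-Poisson algebra su_q^P(2) satisfies the Jacobi identity: for all smooth functions f, g, k : ℝ³ → ℝ, {f,{g,k}} + {g,{k,f}} + {k,{f,g}} = 0, so that su_q^P(2) is a Poisson algebra. -/
/-- Partial derivative of a function on ℝ³ in the `i`-th coordinate direction. -/
noncomputable def pd (i : Fin 3) (f : (Fin 3 → ℝ) → ℝ) (x : Fin 3 → ℝ) : ℝ :=
  fderiv ℝ f x (Pi.single i 1)

/-- The bracket of the standard q-Poisson algebra su_q^P(2) on ℝ³ with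
coordinates (h, a, b) = (x 0, x 1, x 2):
{f,g} = a(∂_h f ∂_a g − ∂_a f ∂_h g) − b(∂_h f ∂_b g − ∂_b f ∂_h g)
      + (sinh(2zh)/z)(∂_a f ∂_b g − ∂_b f ∂_a g). -/
noncomputable def suq2Bracket (z : ℝ) (f g : (Fin 3 → ℝ) → ℝ) (x : Fin 3 → ℝ) : ℝ :=
  x 1 * (pd 0 f x * pd 1 g x - pd 1 f x * pd 0 g x)
  - x 2 * (pd 0 f x * pd 2 g x - pd 2 f x * pd 0 g x)
  + (Real.sinh (2 * z * x 0) / z) * (pd 1 f x * pd 2 g x - pd 2 f x * pd 1 g x)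

theorem differentiable_pd {f : (Fin 3 → ℝ) → ℝ} (hf : ContDiff ℝ 2 f) (i : Fin 3) :
    Differentiable ℝ (pd i f) := by
  have h : ContDiff ℝ 1 (fderiv ℝ f) := hf.fderiv_right (by norm_num)
  exact fun x => ((h.differentiable one_ne_zero) x).clm_apply (differentiableAt_const _)

theorem pd_comm {f : (Fin 3 → ℝ) → ℝ} (hf : ContDiff ℝ 2 f) (i j : Fin 3) (x : Fin 3 → ℝ) :
    pd i (pd j f) x = pd j (pd i f) x := by
  have h : ContDiff ℝ 1 (fderiv ℝ f) := hf.fderiv_right (by norm_num)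
  have hd : DifferentiableAt ℝ (fderiv ℝ f) x := h.differentiable one_ne_zero x
  have key : ∀ i j, pd i (pd j f) x =
      fderiv ℝ (fderiv ℝ f) x (Pi.single i 1) (Pi.single j 1) := by
    intro i j
    change fderiv ℝ (fun y => fderiv ℝ f y (Pi.single j 1)) x (Pi.single i 1) = _
    rw [fderiv_clm_apply hd (differentiableAt_const _)]
    simp
  rw [key, key]
  exact (hf.contDiffAt.isSymmSndFDerivAt (by simp)).eq _ _

section

variable {f g : (Fin 3 → ℝ) → ℝ} {x : Fin 3 → ℝ}

theorem pd_add (hf : DifferentiableAt ℝ f x) (hg : DifferentiableAt ℝ g x) (i : Fin 3) :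
    pd i (fun y => f y + g y) x = pd i f x + pd i g x := by
  simp [pd, fderiv_fun_add hf hg]

theorem pd_sub (hf : DifferentiableAt ℝ f x) (hg : DifferentiableAt ℝ g x) (i : Fin 3) :
    pd i (fun y => f y - g y) x = pd i f x - pd i g x := by
  simp [pd, fderiv_fun_sub hf hg]

theorem pd_mul (hf : DifferentiableAt ℝ f x) (hg : DifferentiableAt ℝ g x) (i : Fin 3) :
    pd i (fun y => f y * g y) x = f x * pd i g x + g x * pd i f x := by
  simp [pd, fderiv_fun_mul hf hg]

end

theorem pd_coord (i j : Fin 3) (x : Fin 3 → ℝ) :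
    pd i (fun y => y j) x = if j = i then 1 else 0 := by
  have h : HasFDerivAt (fun y : Fin 3 → ℝ => y j)
      (ContinuousLinearMap.proj (R := ℝ) (φ := fun _ : Fin 3 => ℝ) j) x := hasFDerivAt_apply j x
  simp [pd, h.fderiv, Pi.single_apply]

theorem pd_comp_coord {s : ℝ → ℝ} {x : Fin 3 → ℝ} {j : Fin 3}
    (hs : DifferentiableAt ℝ s (x j)) (i : Fin 3) :
    pd i (fun y => s (y j)) x = if j = i then deriv s (x j) else 0 := by
  have h : HasFDerivAt (fun y : Fin 3 → ℝ => y j)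
      (ContinuousLinearMap.proj (R := ℝ) (φ := fun _ : Fin 3 => ℝ) j) x := hasFDerivAt_apply j x
  have hc := hs.hasDerivAt.comp_hasFDerivAt x h
  have he : (fun y : Fin 3 → ℝ => s (y j)) = s ∘ fun y => y j := rfl
  simp [pd, he, hc.fderiv, Pi.single_apply]

theorem pd_suq2Bracket (z : ℝ) {f g : (Fin 3 → ℝ) → ℝ} (hf : ContDiff ℝ 2 f)
    (hg : ContDiff ℝ 2 g) (i : Fin 3) (x : Fin 3 → ℝ) :
    pd i (suq2Bracket z f g) x =
      (if 1 = i then 1 else 0) * (pd 0 f x * pd 1 g x - pd 1 f x * pd 0 g x)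
      + x 1 * (pd i (pd 0 f) x * pd 1 g x + pd 0 f x * pd i (pd 1 g) x
        - pd i (pd 1 f) x * pd 0 g x - pd 1 f x * pd i (pd 0 g) x)
      - (if 2 = i then 1 else 0) * (pd 0 f x * pd 2 g x - pd 2 f x * pd 0 g x)
      - x 2 * (pd i (pd 0 f) x * pd 2 g x + pd 0 f x * pd i (pd 2 g) x
        - pd i (pd 2 f) x * pd 0 g x - pd 2 f x * pd i (pd 0 g) x)
      + (if 0 = i then deriv (fun t => Real.sinh (2 * z * t) / z) (x 0) else 0)
        * (pd 1 f x * pd 2 g x - pd 2 f x * pd 1 g x)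
      + (Real.sinh (2 * z * x 0) / z)
        * (pd i (pd 1 f) x * pd 2 g x + pd 1 f x * pd i (pd 2 g) x
        - pd i (pd 2 f) x * pd 1 g x - pd 2 f x * pd i (pd 1 g) x) := by
  have df := fun j => differentiable_pd hf j
  have dg := fun j => differentiable_pd hg j
  have hs : Differentiable ℝ fun t : ℝ => Real.sinh (2 * z * t) / z := by fun_prop
  have hsx : Differentiable ℝ fun y : Fin 3 → ℝ => Real.sinh (2 * z * y 0) / z := by fun_prop
  have hm : ∀ j l, Differentiable ℝ fun y => pd j f y * pd l g y - pd l f y * pd j g y :=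
    fun j l => ((df j).mul (dg l)).sub ((df l).mul (dg j))
  have hc : ∀ j, Differentiable ℝ fun y : Fin 3 → ℝ => y j := fun j => by fun_prop
  have hp : ∀ j l, pd i (fun y => pd j f y * pd l g y - pd l f y * pd j g y) x =
      pd j f x * pd i (pd l g) x + pd l g x * pd i (pd j f) x
        - (pd l f x * pd i (pd j g) x + pd j g x * pd i (pd l f) x) := fun j l => by
    rw [pd_sub ((df j x).fun_mul (dg l x)) ((df l x).fun_mul (dg j x)), pd_mul (df j x) (dg l x),
      pd_mul (df l x) (dg j x)]
  change pd i (fun y => y 1 * (pd 0 f y * pd 1 g y - pd 1 f y * pd 0 g y)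
    - y 2 * (pd 0 f y * pd 2 g y - pd 2 f y * pd 0 g y)
    + (Real.sinh (2 * z * y 0) / z) * (pd 1 f y * pd 2 g y - pd 2 f y * pd 1 g y)) x = _
  rw [pd_add (((hc 1 x).fun_mul (hm 0 1 x)).fun_sub ((hc 2 x).fun_mul (hm 0 2 x)))
      ((hsx x).fun_mul (hm 1 2 x)),
    pd_sub ((hc 1 x).fun_mul (hm 0 1 x)) ((hc 2 x).fun_mul (hm 0 2 x)),
    pd_mul (hc 1 x) (hm 0 1 x), pd_mul (hc 2 x) (hm 0 2 x), pd_mul (hsx x) (hm 1 2 x),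
    hp, hp, hp, pd_coord, pd_coord, pd_comp_coord (j := 0) (hs (x 0))]
  ring

/-- the su_q^P(2) bracket satisfies the Jacobi identity. -/
theorem suq2_jacobi (z : ℝ) (hz : z ≠ 0)
    (f g k : (Fin 3 → ℝ) → ℝ)
    (hf : ContDiff ℝ (⊤ : ℕ∞) f) (hg : ContDiff ℝ (⊤ : ℕ∞) g) (hk : ContDiff ℝ (⊤ : ℕ∞) k) :
    ∀ x : Fin 3 → ℝ,
      suq2Bracket z f (suq2Bracket z g k) x
      + suq2Bracket z g (suq2Bracket z k f) x
      + suq2Bracket z k (suq2Bracket z f g) x = 0 := by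
  intro x
  have hf2 : ContDiff ℝ 2 f := contDiff_infty.1 hf 2
  have hg2 : ContDiff ℝ 2 g := contDiff_infty.1 hg 2
  have hk2 : ContDiff ℝ 2 k := contDiff_infty.1 hk 2
  rw [suq2Bracket, suq2Bracket.eq_1 z g, suq2Bracket.eq_1 z k]
  simp only [pd_suq2Bracket z hf2 hg2, pd_suq2Bracket z hg2 hk2, pd_suq2Bracket z hk2 hf2,
    pd_comm hf2 1 0, pd_comm hf2 2 0, pd_comm hf2 2 1,
    pd_comm hg2 1 0, pd_comm hg2 2 0, pd_comm hg2 2 1,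
    pd_comm hk2 1 0, pd_comm hk2 2 0, pd_comm hk2 2 1]
  generalize Real.sinh (2 * z * x 0) / z = S
  generalize deriv (fun t => Real.sinh (2 * z * t) / z) (x 0) = S'
  simp only [Fin.isValue, Fin.reduceEq, if_true, if_false]
  ring
end

section
/- The function C(h,a,b) = sinh²(zh)/z² + a·b is a Casimir function of the standard q-Poisson algebra su_q^P(2): for every smooth function f : ℝ³ → ℝ, {C, f} = 0. -/
/-- The deformed Casimir C(h,a,b) = sinh²(zh)/z² + a·b. -/
noncomputable def suq2Casimir (z : ℝ) (x : Fin 3 → ℝ) : ℝ :=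
  Real.sinh (z * x 0) ^ 2 / z ^ 2 + x 1 * x 2

theorem hasFDerivAt_suq2Casimir (z : ℝ) (x : Fin 3 → ℝ) :
    HasFDerivAt (suq2Casimir z)
      ((Real.sinh (2 * z * x 0) / z) • ContinuousLinearMap.proj (R := ℝ) (φ := fun _ : Fin 3 => ℝ) 0
        + x 2 • ContinuousLinearMap.proj (R := ℝ) (φ := fun _ : Fin 3 => ℝ) 1
        + x 1 • ContinuousLinearMap.proj (R := ℝ) (φ := fun _ : Fin 3 => ℝ) 2) x := by
  have hp (i : Fin 3) : HasFDerivAt (fun y : Fin 3 → ℝ => y i)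
      (ContinuousLinearMap.proj (R := ℝ) (φ := fun _ : Fin 3 => ℝ) i) x :=
    hasFDerivAt_apply i x
  have hs : HasDerivAt (fun t : ℝ => Real.sinh (z * t) ^ 2 / z ^ 2)
      (Real.sinh (2 * z * x 0) / z) (x 0) := by
    have h := ((((hasDerivAt_id (x 0)).const_mul z).sinh).pow 2).div_const (z ^ 2)
    refine h.congr_deriv ?_
    rw [mul_assoc 2 z, Real.sinh_two_mul]
    rcases eq_or_ne z 0 with rfl | hz
    · simp
    · simp
      field_simp
  refine ((hs.comp_hasFDerivAt x (hp 0)).add ((hp 1).mul (hp 2))).congr_fderiv ?_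
  abel

theorem fderiv_suq2Casimir_apply (z : ℝ) (x v : Fin 3 → ℝ) :
    fderiv ℝ (suq2Casimir z) x v =
      Real.sinh (2 * z * x 0) / z * v 0 + x 2 * v 1 + x 1 * v 2 := by
  simp [(hasFDerivAt_suq2Casimir z x).fderiv]

/-- C is a Casimir function of su_q^P(2). -/
theorem suq2_casimir (z : ℝ) (hz : z ≠ 0)
    (f : (Fin 3 → ℝ) → ℝ) (hf : ContDiff ℝ (⊤ : ℕ∞) f) :
    ∀ x : Fin 3 → ℝ, suq2Bracket z (suq2Casimir z) f x = 0 := by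
  intro x
  have h0 : pd 0 (suq2Casimir z) x = Real.sinh (2 * z * x 0) / z := by
    simp [pd, fderiv_suq2Casimir_apply]
  have h1 : pd 1 (suq2Casimir z) x = x 2 := by
    simp [pd, fderiv_suq2Casimir_apply]
  have h2 : pd 2 (suq2Casimir z) x = x 1 := by
    simp [pd, fderiv_suq2Casimir_apply]
  rw [suq2Bracket, h0, h1, h2]
  ring
end

section
/- The coproduct of su_q^P(2) is compatible with the Poisson brackets on the generators: as smooth functions on ℝ³×ℝ³ one has {Δ(h), Δ(a)} = Δ(a), {Δ(h), Δ(b)} = −Δ(b), and {Δ(a), Δ(b)} = sinh(2z(h+h'))/z, where the brackets on the left are the product Poisson bracket. -/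
/-- The product Poisson bracket on ℝ³ × ℝ³. -/
noncomputable def suq2Bracket2 (z : ℝ) (F G : (Fin 3 → ℝ) × (Fin 3 → ℝ) → ℝ)
    (p : (Fin 3 → ℝ) × (Fin 3 → ℝ)) : ℝ :=
  suq2Bracket z (fun y => F (y, p.2)) (fun y => G (y, p.2)) p.1
  + suq2Bracket z (fun y => F (p.1, y)) (fun y => G (p.1, y)) p.2

/-- Coproduct of the generator H: Δ(h) = h + h'. -/
noncomputable def DH : (Fin 3 → ℝ) × (Fin 3 → ℝ) → ℝ := fun p => p.1 0 + p.2 0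

/-- Coproduct of the generator F₁₂: Δ(a) = e^{zh}a' + a·e^{−zh'}. -/
noncomputable def DA (z : ℝ) : (Fin 3 → ℝ) × (Fin 3 → ℝ) → ℝ := fun p =>
  Real.exp (z * p.1 0) * p.2 1 + p.1 1 * Real.exp (-(z * p.2 0))

/-- Coproduct of the generator F₂₁: Δ(b) = e^{zh}b' + b·e^{−zh'}. -/
noncomputable def DB (z : ℝ) : (Fin 3 → ℝ) × (Fin 3 → ℝ) → ℝ := fun p =>
  Real.exp (z * p.1 0) * p.2 2 + p.1 2 * Real.exp (-(z * p.2 0))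

theorem pd_coord_add_const (i j : Fin 3) (c : ℝ) (x : Fin 3 → ℝ) :
    pd j (fun y => y i + c) x = (Pi.single j 1 : Fin 3 → ℝ) i := by
  have h : HasFDerivAt (fun y : Fin 3 → ℝ => y i + c)
      (ContinuousLinearMap.proj (R := ℝ) (φ := fun _ : Fin 3 => ℝ) i) x :=
    (hasFDerivAt_apply i x).add_const c
  simp [pd, h.fderiv]

theorem pd_exp_mul_add_coord_mul (i j : Fin 3) (k c d : ℝ) (x : Fin 3 → ℝ) :
    pd j (fun y => Real.exp (k * y 0) * c + y i * d) x =
      k * Real.exp (k * x 0) * c * (Pi.single j 1 : Fin 3 → ℝ) 0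
        + d * (Pi.single j 1 : Fin 3 → ℝ) i := by
  have h0 := hasFDerivAt_apply (𝕜 := ℝ) (0 : Fin 3) x
  have hi := hasFDerivAt_apply (𝕜 := ℝ) i x
  have h := ((h0.const_mul k).exp.mul_const c).add (hi.mul_const d)
  have h' : pd j (fun y => Real.exp (k * y 0) * c + y i * d) x = _ :=
    congrArg (fun L => L (Pi.single j 1)) h.fderiv
  rw [h']
  simp
  ring

theorem pd_mul_coord_add_mul_exp_neg (i j : Fin 3) (z c d : ℝ) (x : Fin 3 → ℝ) :
    pd j (fun y => d * y i + c * Real.exp (-(z * y 0))) x =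
      -z * Real.exp (-(z * x 0)) * c * (Pi.single j 1 : Fin 3 → ℝ) 0
        + d * (Pi.single j 1 : Fin 3 → ℝ) i := by
  have h := pd_exp_mul_add_coord_mul i j (-z) c d x
  simp only [neg_mul] at h ⊢
  rw [← h]
  congr 1
  funext y
  ring

/-- the coproduct of su_q^P(2) is compatible with the Poisson
brackets on the generators. -/
theorem suq2_coproduct_compatible (z : ℝ) (hz : z ≠ 0) :
    (∀ p, suq2Bracket2 z DH (DA z) p = DA z p) ∧
    (∀ p, suq2Bracket2 z DH (DB z) p = - DB z p) ∧
    (∀ p, suq2Bracket2 z (DA z) (DB z) p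
        = Real.sinh (2 * z * (p.1 0 + p.2 0)) / z) := by
  have hDH (c : ℝ) (j : Fin 3) (x : Fin 3 → ℝ) :
      pd j (fun y => c + y 0) x = (Pi.single j 1 : Fin 3 → ℝ) 0 := by
    simpa only [add_comm c] using pd_coord_add_const 0 j c x
  refine ⟨fun p => ?_, fun p => ?_, fun p => ?_⟩
  · simp [suq2Bracket2, suq2Bracket, DH, DA, hDH, pd_coord_add_const,
      pd_exp_mul_add_coord_mul, pd_mul_coord_add_mul_exp_neg]
    ring
  · simp [suq2Bracket2, suq2Bracket, DH, DB, hDH, pd_coord_add_const,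
      pd_exp_mul_add_coord_mul, pd_mul_coord_add_mul_exp_neg]
    ring
  · have e₁ (t : ℝ) : Real.exp (2 * z * t) = Real.exp (z * t) ^ 2 := by
      rw [← Real.exp_nat_mul]; push_cast; ring_nf
    simp [suq2Bracket2, suq2Bracket, DA, DB,
      pd_exp_mul_add_coord_mul, pd_mul_coord_add_mul_exp_neg]
    simp only [Real.sinh_eq, Real.exp_neg, e₁, mul_add, Real.exp_add]
    field_simp
    ring
end

section
/- The function C(h,a,b) = h² + (sinh(za)/z)·b is a Casimir function of the non-standard q-Poisson algebra su_ns^P(2): for every smooth function f : ℝ³ → ℝ, {C, f} = 0. -/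
/-- The bracket of the non-standard q-Poisson algebra su_ns^P(2) on ℝ³ with
coordinates (h, a, b) = (x 0, x 1, x 2). -/
noncomputable def suns2Bracket (z : ℝ) (f g : (Fin 3 → ℝ) → ℝ) (x : Fin 3 → ℝ) : ℝ :=
  (Real.sinh (z * x 1) / z) * (pd 0 f x * pd 1 g x - pd 1 f x * pd 0 g x)
  - x 2 * Real.cosh (z * x 1) * (pd 0 f x * pd 2 g x - pd 2 f x * pd 0 g x)
  + 2 * x 0 * (pd 1 f x * pd 2 g x - pd 2 f x * pd 1 g x)

/-- The non-standard deformed Casimir C(h,a,b) = h² + (sinh(za)/z)·b. -/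
noncomputable def suns2Casimir (z : ℝ) (x : Fin 3 → ℝ) : ℝ :=
  x 0 ^ 2 + (Real.sinh (z * x 1) / z) * x 2

theorem hasFDerivAt_suns2Casimir {z : ℝ} (hz : z ≠ 0) (x : Fin 3 → ℝ) :
    HasFDerivAt (suns2Casimir z)
      ((2 * x 0) • ContinuousLinearMap.proj (R := ℝ) (φ := fun _ : Fin 3 => ℝ) 0
        + (x 2 * Real.cosh (z * x 1)) • ContinuousLinearMap.proj 1
        + (Real.sinh (z * x 1) / z) • ContinuousLinearMap.proj 2) x := by
  have hcoord (i : Fin 3) : HasFDerivAt (fun y : Fin 3 → ℝ => y i)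
      (ContinuousLinearMap.proj (R := ℝ) (φ := fun _ : Fin 3 => ℝ) i) x :=
    hasFDerivAt_apply i x
  have hsinh : HasDerivAt (fun t => Real.sinh (z * t) / z) (Real.cosh (z * x 1)) (x 1) := by
    refine ((((hasDerivAt_id (x 1)).const_mul z).sinh).div_const z).congr_deriv ?_
    simp [hz]
  refine (((hcoord 0).pow 2).add
    ((hsinh.comp_hasFDerivAt x (hcoord 1)).mul (hcoord 2))).congr_fderiv ?_
  ext v
  simp
  ring

/-- C is a Casimir function of su_ns^P(2). -/
theorem suns2_casimir (z : ℝ) (hz : z ≠ 0)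
    (f : (Fin 3 → ℝ) → ℝ) (hf : ContDiff ℝ (⊤ : ℕ∞) f) :
    ∀ x : Fin 3 → ℝ, suns2Bracket z (suns2Casimir z) f x = 0 := by
  intro x
  simp only [suns2Bracket, pd, (hasFDerivAt_suns2Casimir hz x).fderiv]
  simp
  ring
end

section
/- The su_q^P(3) coproduct of the non-simple root generator F₁₃ is coassociative: as smooth functions on ℝ⁹×ℝ⁹×ℝ⁹ (coordinates of the three copies unprimed, primed, double-primed), (Δ⊗id)(Δ(a₁₃)) = (id⊗Δ)(Δ(a₁₃)), where on products and exponentials Δ is extended multiplicatively (in particular Δ(e^{λ(hᵢ−hⱼ)}) = e^{λ(hᵢ−hⱼ)}·e^{λ(hᵢ'−hⱼ')}), and (Δ⊗id), (id⊗Δ) apply this extension in the first, respectively second, tensor factor. -/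
/-- Coproduct Δ(a₁₂) as a function on ℝ⁹ × ℝ⁹; coordinates on each copy are
(h₁,h₂,h₃,a₁₂,a₂₁,a₂₃,a₃₂,a₁₃,a₃₁) = (x 0,…,x 8). -/
noncomputable def Da12 (z : ℝ) : (Fin 9 → ℝ) × (Fin 9 → ℝ) → ℝ := fun p =>
  Real.exp (z * (p.1 0 - p.1 1) / 2) * p.2 3
  + p.1 3 * Real.exp (-(z * (p.2 0 - p.2 1) / 2))

/-- Coproduct Δ(a₂₃). -/
noncomputable def Da23 (z : ℝ) : (Fin 9 → ℝ) × (Fin 9 → ℝ) → ℝ := fun p =>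
  Real.exp (z * (p.1 1 - p.1 2) / 2) * p.2 5
  + p.1 5 * Real.exp (-(z * (p.2 1 - p.2 2) / 2))

/-- Coproduct Δ(a₁₃). -/
noncomputable def Da13 (z : ℝ) : (Fin 9 → ℝ) × (Fin 9 → ℝ) → ℝ := fun p =>
  Real.exp (z * (p.1 0 - p.1 2) / 2) * p.2 7
  + p.1 7 * Real.exp (-(z * (p.2 0 - p.2 2) / 2))
  + z * (Real.exp (z * (p.1 1 - p.1 2) / 2) * p.1 3
           * (Real.exp (-(z * (p.2 0 - p.2 1) / 2)) * p.2 5)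
         - Real.exp (z * (p.1 0 - p.1 1) / 2) * p.1 5
           * (Real.exp (-(z * (p.2 1 - p.2 2) / 2)) * p.2 3))

/-- coassociativity of the su_q^P(3) coproduct on the non-simple
root generator F₁₃: (Δ⊗id)(Δ(a₁₃)) = (id⊗Δ)(Δ(a₁₃)) as functions on
ℝ⁹ × ℝ⁹ × ℝ⁹ (copies x, y, w).  Δ is extended multiplicatively to products
and to exponentials of the Cartan generators, so that
Δ(e^{λ(hᵢ−hⱼ)}) = e^{λ(hᵢ−hⱼ)}·e^{λ(hᵢ'−hⱼ')}, and (Δ⊗id), (id⊗Δ) apply this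
extension in the first, respectively second, tensor factor of
Δ(a₁₃) = e^{z(h₁−h₃)/2} ⊗ a₁₃ + a₁₃ ⊗ e^{−z(h₁−h₃)/2}
  + z(e^{z(h₂−h₃)/2}a₁₂ ⊗ e^{−z(h₁−h₂)/2}a₂₃ − e^{z(h₁−h₂)/2}a₂₃ ⊗ e^{−z(h₂−h₃)/2}a₁₂). -/
theorem suq3_coassoc_a13 (z : ℝ) (hz : z ≠ 0) :
    ∀ x y w : Fin 9 → ℝ,
      -- (Δ⊗id)(Δ(a₁₃)) evaluated at (x, y, w):
      (Real.exp (z * (x 0 - x 2) / 2) * Real.exp (z * (y 0 - y 2) / 2)) * w 7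
      + Da13 z (x, y) * Real.exp (-(z * (w 0 - w 2) / 2))
      + z * ((Real.exp (z * (x 1 - x 2) / 2) * Real.exp (z * (y 1 - y 2) / 2)
                * Da12 z (x, y))
              * (Real.exp (-(z * (w 0 - w 1) / 2)) * w 5)
             - (Real.exp (z * (x 0 - x 1) / 2) * Real.exp (z * (y 0 - y 1) / 2)
                * Da23 z (x, y))
              * (Real.exp (-(z * (w 1 - w 2) / 2)) * w 3))
      =
      -- (id⊗Δ)(Δ(a₁₃)) evaluated at (x, y, w):
      Real.exp (z * (x 0 - x 2) / 2) * Da13 z (y, w)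
      + x 7 * (Real.exp (-(z * (y 0 - y 2) / 2)) * Real.exp (-(z * (w 0 - w 2) / 2)))
      + z * ((Real.exp (z * (x 1 - x 2) / 2) * x 3)
              * (Real.exp (-(z * (y 0 - y 1) / 2)) * Real.exp (-(z * (w 0 - w 1) / 2))
                 * Da23 z (y, w))
             - (Real.exp (z * (x 0 - x 1) / 2) * x 5)
              * (Real.exp (-(z * (y 1 - y 2) / 2)) * Real.exp (-(z * (w 1 - w 2) / 2))
                 * Da12 z (y, w))) := by
  intro x y w
  have exp_split (u : Fin 9 → ℝ) : Real.exp (z * (u 0 - u 2) / 2) =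
      Real.exp (z * (u 0 - u 1) / 2) * Real.exp (z * (u 1 - u 2) / 2) := by
    rw [← Real.exp_add]
    ring_nf
  have exp_neg_split (u : Fin 9 → ℝ) : Real.exp (-(z * (u 0 - u 2) / 2)) =
      Real.exp (-(z * (u 0 - u 1) / 2)) * Real.exp (-(z * (u 1 - u 2) / 2)) := by
    rw [← Real.exp_add]
    ring_nf
  simp only [Da12, Da23, Da13, exp_split, exp_neg_split]
  ring1
end
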